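/- arXiv:2504.02601 — 2 statements merged into one kernel-verified Lean document; each statement's English description precedes it below -/
import Mathlib

section
/- Every module in the class of S-strongly flat R-modules is flat. -/
open CategoryTheory

noncomputable def ext1Zero (R : Type) [CommRing R] (M N : Type) [AddCommGroup M] [Module R M]
    [AddCommGroup N] [Module R N] : Prop :=
  Subsingleton (((Ext R (ModuleCat R) 1).obj (Opposite.op (ModuleCat.of R M))).obj
    (ModuleCat.of R N))

/-- An `R`-module `C` is `S`-weakly cotorsion if `Ext¹_R(R_S, C) = 0`. -/
noncomputable def SWeaklyCotorsion (R : Type) [CommRing R] (S : Submonoid R) (C : Type)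
    [AddCommGroup C] [Module R C] : Prop :=
  ext1Zero R (Localization S) C

/-- An `R`-module `F` is `S`-strongly flat if `Ext¹_R(F, C) = 0` for every
`S`-weakly cotorsion `R`-module `C`. -/
noncomputable def SStronglyFlat (R : Type) [CommRing R] (S : Submonoid R) (F : Type)
    [AddCommGroup F] [Module R F] : Prop :=
  ∀ (C : Type) [AddCommGroup C] [Module R C], SWeaklyCotorsion R S C → ext1Zero R F C

/-- Vanishing of `Ext¹` in terms of a projective resolution. -/
lemma ext1_iff {R : Type} [CommRing R] {M : ModuleCat.{0} R} (P : ProjectiveResolution M)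
    (N : ModuleCat.{0} R) :
    Subsingleton (((Ext R (ModuleCat R) 1).obj (Opposite.op M)).obj N) ↔
      ∀ f : P.complex.X 1 ⟶ N, P.complex.d 2 1 ≫ f = 0 →
        ∃ g : P.complex.X 0 ⟶ N, P.complex.d 1 0 ≫ g = f := by
  rw [← ModuleCat.isZero_iff_subsingleton, (P.isoExt (R := R) 1 N).isZero_iff,
    ← HomologicalComplex.exactAt_iff_isZero_homology,
    HomologicalComplex.exactAt_iff' _ 0 1 2 (by simp) (by simp),
    ShortComplex.moduleCat_exact_iff]
  rfl

lemma hom_surj_of_ext1 {R : Type} [CommRing R] {M : ModuleCat.{0} R}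
    {T : ShortComplex (ModuleCat.{0} R)} (hT : T.ShortExact)
    (h : Subsingleton (((Ext R (ModuleCat R) 1).obj (Opposite.op M)).obj T.X₁))
    (g : M ⟶ T.X₃) : ∃ g' : M ⟶ T.X₂, g' ≫ T.g = g := by
  let P := projectiveResolution M
  rw [ext1_iff P] at h
  have := hT.mono_f
  have := hT.epi_g
  have hd : P.complex.d 1 0 ≫ P.π.f 0 = 0 := P.complex_d_comp_π_f_zero
  have he : Epi (P.π.f 0) := inferInstance
  let q : P.complex.X 0 ⟶ M := P.π.f 0
  have hdq : P.complex.d 1 0 ≫ q = 0 := hd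
  have hq : Epi q := he
  let t : P.complex.X 0 ⟶ T.X₂ := Projective.factorThru (q ≫ g) T.g
  have ht : t ≫ T.g = q ≫ g := Projective.factorThru_comp _ _
  have h0 : (P.complex.d 1 0 ≫ t) ≫ T.g = 0 := by
    rw [Category.assoc, ht, ← Category.assoc, hdq, Limits.zero_comp]
  obtain ⟨k, hk⟩ := h (hT.exact.lift _ h0) (by
    rw [← cancel_mono T.f, Category.assoc, hT.exact.lift_f]; simp)
  have hk' : P.complex.d 1 0 ≫ (t - k ≫ T.f) = 0 := by
    rw [Preadditive.comp_sub, ← Category.assoc, hk, hT.exact.lift_f, sub_self]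
  have hex : (ShortComplex.mk _ _ hdq).Exact := P.exact₀
  refine ⟨hex.desc _ hk', ?_⟩
  rw [← cancel_epi q, ← Category.assoc]
  have : q ≫ hex.desc _ hk' = t - k ≫ T.f := hex.g_desc _ hk'
  rw [this, Preadditive.sub_comp, ht, Category.assoc, T.zero]
  simp

lemma ext1_of_hom_surj {R : Type} [CommRing R] {M : ModuleCat.{0} R}
    {T : ShortComplex (ModuleCat.{0} R)} (hT : T.ShortExact) [Injective T.X₂]
    (h : ∀ g : M ⟶ T.X₃, ∃ g' : M ⟶ T.X₂, g' ≫ T.g = g) :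
    Subsingleton (((Ext R (ModuleCat R) 1).obj (Opposite.op M)).obj T.X₁) := by
  let P := projectiveResolution M
  rw [ext1_iff P]
  intro f hf
  have := hT.mono_f
  have := hT.epi_g
  have hd : P.complex.d 1 0 ≫ P.π.f 0 = 0 := P.complex_d_comp_π_f_zero
  have he : Epi (P.π.f 0) := inferInstance
  let q : P.complex.X 0 ⟶ M := P.π.f 0
  have hdq : P.complex.d 1 0 ≫ q = 0 := hd
  have hq : Epi q := he
  have hex : (ShortComplex.mk _ _ hdq).Exact := P.exact₀
  have hex1 := P.exact_succ 0
  let s : P.complex.X 0 ⟶ T.X₂ := hex1.descToInjective (f ≫ T.f) (by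
    change P.complex.d 2 1 ≫ f ≫ T.f = 0
    rw [← Category.assoc, hf, Limits.zero_comp])
  have hs : P.complex.d 1 0 ≫ s = f ≫ T.f := hex1.comp_descToInjective _ _
  have h0 : P.complex.d 1 0 ≫ (s ≫ T.g) = 0 := by
    rw [← Category.assoc, hs, Category.assoc, T.zero, Limits.comp_zero]
  obtain ⟨g', hg'⟩ := h (hex.desc _ h0)
  have hqd : q ≫ hex.desc _ h0 = s ≫ T.g := hex.g_desc _ h0
  have h1 : (s - q ≫ g') ≫ T.g = 0 := by
    rw [Preadditive.sub_comp, Category.assoc, hg', hqd, sub_self]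
  refine ⟨hT.exact.lift _ h1, ?_⟩
  rw [← cancel_mono T.f, Category.assoc, hT.exact.lift_f, Preadditive.comp_sub, hs,
    ← Category.assoc, hdq]
  simp

/-- The dual of `0 → I → R → R/I → 0`. -/
noncomputable abbrev dualSC {R : Type} [CommRing R] (I : Ideal R) :
    ShortComplex (ModuleCat.{0} R) :=
  ShortComplex.mk (ModuleCat.ofHom (CharacterModule.dual (Submodule.mkQ I)))
    (ModuleCat.ofHom (CharacterModule.dual (Submodule.subtype I))) (by
      rw [← ModuleCat.ofHom_comp, ← CharacterModule.dual_comp]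
      have : (Submodule.mkQ I) ∘ₗ (Submodule.subtype I) = 0 := by ext x; exact (Submodule.Quotient.mk_eq_zero I).mpr x.2
      rw [this, CharacterModule.dual_zero]; rfl)

lemma dualSC_shortExact {R : Type} [CommRing R] (I : Ideal R) : (dualSC I).ShortExact where
  exact := by
    rw [ShortComplex.moduleCat_exact_iff]
    intro (c : CharacterModule R) hc
    have hc' : ∀ x ∈ I, c x = 0 := fun x hx => by
      have hc2 : CharacterModule.dual (Submodule.subtype I) c = 0 := hc
      exact DFunLike.congr_fun hc2 (⟨x, hx⟩ : I)
    refine ⟨(QuotientAddGroup.lift I.toAddSubgroup c hc' : (R ⧸ I) →+ AddCircle (1 : ℚ)), ?_⟩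
    exact CharacterModule.ext R (fun x => rfl)
  mono_f := by
    rw [ModuleCat.mono_iff_injective]
    exact CharacterModule.dual_injective_of_surjective _ (Submodule.mkQ_surjective I)
  epi_g := by
    rw [ModuleCat.epi_iff_surjective]
    exact CharacterModule.dual_surjective_of_injective _ (Submodule.subtype_injective I)

lemma lTensor_inj_iff {R : Type} [CommRing R] (I : Ideal R) (M : Type) [AddCommGroup M]
    [Module R M] :
    Function.Injective ((Submodule.subtype I).lTensor M) ↔
      ∀ g : M →ₗ[R] CharacterModule I, ∃ g' : M →ₗ[R] CharacterModule R,
        CharacterModule.dual (Submodule.subtype I) ∘ₗ g' = g := by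
  rw [← CharacterModule.dual_surjective_iff_injective]
  constructor
  · intro h g
    obtain ⟨c, hc⟩ := h (CharacterModule.homEquiv g)
    refine ⟨CharacterModule.homEquiv.symm c, ?_⟩
    rw [← CharacterModule.homEquiv.symm_apply_apply g, ← hc]
    rfl
  · intro h c
    obtain ⟨g', hg'⟩ := h (CharacterModule.homEquiv.symm c)
    refine ⟨CharacterModule.homEquiv g', ?_⟩
    apply CharacterModule.homEquiv.symm.injective
    rw [← hg']
    conv_rhs => rw [← CharacterModule.homEquiv.symm_apply_apply g']
    rfl

lemma cat_iff {R : Type} [CommRing R] (I : Ideal R) (M : Type) [AddCommGroup M]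
    [Module R M] :
    Function.Injective ((Submodule.subtype I).lTensor M) ↔
      ∀ g : ModuleCat.of R M ⟶ (dualSC I).X₃, ∃ g' : ModuleCat.of R M ⟶ (dualSC I).X₂,
        g' ≫ (dualSC I).g = g := by
  rw [lTensor_inj_iff]
  constructor
  · intro h g
    obtain ⟨g', hg'⟩ := h g.hom
    exact ⟨ModuleCat.ofHom g', ModuleCat.hom_ext hg'⟩
  · intro h g
    obtain ⟨g', hg'⟩ := h (ModuleCat.ofHom g)
    exact ⟨g'.hom, congrArg ModuleCat.Hom.hom hg'⟩

lemma ext1Zero_iff {R : Type} [CommRing R] (I : Ideal R) (M : Type) [AddCommGroup M]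
    [Module R M] :
    ext1Zero R M (CharacterModule (R ⧸ I)) ↔
      Function.Injective ((Submodule.subtype I).lTensor M) := by
  have hinj : Module.Injective R (CharacterModule R) :=
    Module.Flat.iff_characterModule_injective.mp inferInstance
  have : Injective (dualSC I).X₂ := Module.injective_object_of_injective_module R _
  constructor
  · intro h
    unfold ext1Zero at h
    refine (cat_iff I M).mpr fun g => ?_
    exact hom_surj_of_ext1 (T := dualSC I) (dualSC_shortExact I) h g
  · intro h
    unfold ext1Zero
    exact ext1_of_hom_surj (T := dualSC I) (dualSC_shortExact I) ((cat_iff I M).mp h)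

theorem stmt_0 (R : Type) [CommRing R] (S : Submonoid R) (F : Type) [AddCommGroup F] [Module R F]
    (hF : SStronglyFlat R S F) : Module.Flat R F := by
  rw [Module.Flat.iff_lTensor_injective']
  intro I
  rw [← ext1Zero_iff]
  apply hF
  have : Module.Flat R (Localization S) := IsLocalization.flat _ S
  exact (ext1Zero_iff I _).mpr
    (Module.Flat.lTensor_preserves_injective_linearMap _ (Submodule.subtype_injective I))
end

section
/- Every S-strongly flat R-module is optimistically S-strongly flat. -/
open CategoryTheory

open CategoryTheory

/-- A flat `R`-module `F` is optimistically `S`-strongly flat if `F ⊗_R R_S` is a projective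
`R_S`-module and, for every `s ∈ S`, `F/sF` is a projective `R/sR`-module. -/
def OSStronglyFlat (R : Type) [CommRing R] (S : Submonoid R) (F : Type)
    [AddCommGroup F] [Module R F] : Prop :=
  Module.Flat R F ∧
    Module.Projective (Localization S) (LocalizedModule S F) ∧
    ∀ s : R, s ∈ S →
      Module.Projective (R ⧸ Ideal.span {s}) (F ⧸ (Ideal.span {s} • (⊤ : Submodule R F)))

theorem ext1_data_cat (R : Type) [CommRing R] (M : Type) [AddCommGroup M] [Module R M] 
    (P : ProjectiveResolution (ModuleCat.of R M)) (N : Type) [AddCommGroup N] [Module R N] :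
    ext1Zero R M N ↔ ∀ c : P.complex.X 1 ⟶ ModuleCat.of R N, P.complex.d 2 1 ≫ c = 0 →
      ∃ e : P.complex.X 0 ⟶ ModuleCat.of R N, c = P.complex.d 1 0 ≫ e := by
  unfold ext1Zero
  rw [← ModuleCat.isZero_iff_subsingleton, (P.isoExt (R := R) 1 (ModuleCat.of R N)).isZero_iff,
    ← HomologicalComplex.exactAt_iff_isZero_homology, 
    HomologicalComplex.exactAt_iff' _ 0 1 2 (by simp) (by simp),
    ShortComplex.moduleCat_exact_iff]
  constructor
  · intro h c hc
    obtain ⟨e, he⟩ := h c hc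
    exact ⟨e, he.symm⟩
  · intro h c hc
    obtain ⟨e, he⟩ := h c hc
    exact ⟨e, he.symm⟩

theorem ext1_data (R : Type) [CommRing R] (M : Type) [AddCommGroup M] [Module R M] :
    ∃ (P0 P1 P2 : ModuleCat.{0} R) (d2 : P2 →ₗ[R] P1) (d1 : P1 →ₗ[R] P0) (ε : P0 →ₗ[R] M),
      Module.Projective R P0 ∧ Function.Surjective ε ∧ Function.Exact d1 ε ∧ Function.Exact d2 d1 ∧
      ∀ (N : Type) [AddCommGroup N] [Module R N],
        ext1Zero R M N ↔ ∀ c : P1 →ₗ[R] N, c ∘ₗ d2 = 0 → ∃ e : P0 →ₗ[R] N, c = e ∘ₗ d1 := by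
  let P := ProjectiveResolution.of (ModuleCat.of R M)
  let ε : P.complex.X 0 ⟶ ModuleCat.of R M := P.π.f 0
  refine ⟨P.complex.X 0, P.complex.X 1, P.complex.X 2, (P.complex.d 2 1).hom, (P.complex.d 1 0).hom,
    ε.hom, ?_, ?_, ?_, ?_, ?_⟩
  · exact (IsProjective.iff_projective _).2 (P.projective 0)
  · have : Epi (P.π.f 0) := inferInstance
    exact (ModuleCat.epi_iff_surjective ε).1 this
  · exact (ShortComplex.ShortExact.moduleCat_exact_iff_function_exact _).1 P.exact₀
  · exact (ShortComplex.ShortExact.moduleCat_exact_iff_function_exact _).1 (P.exact_succ 0)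
  · intro N _ _
    rw [ext1_data_cat R M P N]
    constructor
    · intro h c hc
      obtain ⟨e, he⟩ := h (ModuleCat.ofHom c) (by ext x; exact LinearMap.congr_fun hc x)
      exact ⟨e.hom, by ext x; exact congr($he x)⟩
    · intro h c hc
      obtain ⟨e, he⟩ := h c.hom (by ext x; exact congr($hc x))
      exact ⟨ModuleCat.ofHom e, by ext x; exact LinearMap.congr_fun he x⟩

theorem descend {R A B C : Type*} [Ring R] [AddCommGroup A] [AddCommGroup B] [AddCommGroup C]
    [Module R A] [Module R B] [Module R C] (g : A →ₗ[R] B) (hg : Function.Surjective g)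
    (f : A →ₗ[R] C) (h : ∀ a, g a = 0 → f a = 0) : ∃ k : B →ₗ[R] C, ∀ a, k (g a) = f a := by
  refine ⟨(LinearMap.ker g).liftQ f (fun a ha => h a ha) ∘ₗ
    (g.quotKerEquivOfSurjective hg).symm.toLinearMap, fun a => ?_⟩
  have : (g.quotKerEquivOfSurjective hg).symm (g a) = (LinearMap.ker g).mkQ a := by
    rw [LinearEquiv.symm_apply_eq]; rfl
  rw [LinearMap.comp_apply, LinearEquiv.coe_coe, this, Submodule.mkQ_apply]
  exact Submodule.liftQ_apply _ _ _

theorem corestrict {R A B C : Type*} [Ring R] [AddCommGroup A] [AddCommGroup B] [AddCommGroup C]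
    [Module R A] [Module R B] [Module R C] (i : A →ₗ[R] B) (hi : Function.Injective i)
    (f : C →ₗ[R] B) (h : ∀ c, ∃ a, i a = f c) : ∃ k : C →ₗ[R] A, ∀ c, i (k c) = f c := by
  refine ⟨(LinearEquiv.ofInjective i hi).symm.toLinearMap ∘ₗ
    f.codRestrict (LinearMap.range i) (fun c => h c), fun c => ?_⟩
  have := congrArg Subtype.val ((LinearEquiv.ofInjective i hi).apply_symm_apply
    (f.codRestrict (LinearMap.range i) (fun c => h c) c))
  exact this

/-- If every map from the kernel of a surjection extends, then `Ext¹` vanishes. -/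
theorem ext1Zero_of_extend (R : Type) [CommRing R] (M N : Type) [AddCommGroup M] [Module R M]
    [AddCommGroup N] [Module R N]
    (H : ∀ (P : Type) [AddCommGroup P] [Module R P] (π : P →ₗ[R] M), Function.Surjective π →
      ∀ f : LinearMap.ker π →ₗ[R] N, ∃ e : P →ₗ[R] N, ∀ k, e k.1 = f k) : ext1Zero R M N := by
  obtain ⟨P0, P1, P2, d2, d1, ε, hP, hε, h1, h2, hN⟩ := ext1_data R M
  rw [hN]
  intro c hc
  obtain ⟨f, hf⟩ := descend (d1.codRestrict (LinearMap.ker ε) fun x => (h1 _).2 ⟨x, rfl⟩)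
    (by rintro ⟨k, hk⟩
        obtain ⟨x, hx⟩ := (h1 _).1 hk
        exact ⟨x, Subtype.ext hx⟩) c
    (by intro a ha
        obtain ⟨y, rfl⟩ := (h2 _).1 (congrArg Subtype.val ha)
        exact LinearMap.congr_fun hc y)
  obtain ⟨e, he⟩ := H P0 ε hε f
  refine ⟨e, LinearMap.ext fun x => ?_⟩
  rw [← hf x, ← he]; rfl

theorem extend_of_ext1Zero (R : Type) [CommRing R] (M N : Type) [AddCommGroup M] [Module R M]
    [AddCommGroup N] [Module R N] (H : ext1Zero R M N) 
    (P : Type) [AddCommGroup P] [Module R P] (π : P →ₗ[R] M) (hπ : Function.Surjective π)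
    (f : LinearMap.ker π →ₗ[R] N) : ∃ e : P →ₗ[R] N, ∀ k, e k.1 = f k := by
  obtain ⟨P0, P1, P2, d2, d1, ε, hP, hε, h1, h2, hN⟩ := ext1_data R M
  rw [hN] at H
  obtain ⟨u, hu⟩ := Module.projective_lifting_property π ε hπ
  have hu (x) : π (u x) = ε x := LinearMap.congr_fun hu x
  let v : P1 →ₗ[R] LinearMap.ker π := (u ∘ₗ d1).codRestrict _
    (fun x => by simp [hu]; exact (h1 _).2 ⟨x, rfl⟩)
  obtain ⟨e, he⟩ := H (f ∘ₗ v) (by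
    ext x
    have : v (d2 x) = 0 := Subtype.ext (by
      change u (d1 (d2 x)) = 0
      rw [(h2 _).2 ⟨x, rfl⟩, map_zero])
    simp [this])
  have he (x) : f (v x) = e (d1 x) := LinearMap.congr_fun he x
  obtain ⟨k, hk⟩ := descend ((LinearMap.ker π).subtype.coprod u)
    (fun p => by
      obtain ⟨x, hx⟩ := hε (π p)
      exact ⟨(⟨p - u x, by simp [hu, hx]⟩, x), by simp⟩)
    (f.coprod e)
    (by
      rintro ⟨⟨a, ha⟩, x⟩ hax
      simp only [LinearMap.coprod_apply, Submodule.subtype_apply] at hax ⊢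
      have hx : ε x = 0 := by
        have := congrArg π hax
        rwa [map_add, LinearMap.mem_ker.1 ha, zero_add, hu, map_zero] at this
      obtain ⟨y, rfl⟩ := (h1 _).1 hx
      rw [← he, ← map_add]
      convert map_zero f
      exact Subtype.ext hax)
  refine ⟨k, fun a => ?_⟩
  have := hk (a, 0)
  simpa using this

theorem lift_of_ext1Zero (R : Type) [CommRing R] (M N : Type) [AddCommGroup M] [Module R M]
    [AddCommGroup N] [Module R N] (H : ext1Zero R M N) 
    {E E' : Type} [AddCommGroup E] [Module R E] [AddCommGroup E'] [Module R E']
    (i : N →ₗ[R] E) (hi : Function.Injective i) (g : E →ₗ[R] E') (hg : Function.Surjective g)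
    (hig : Function.Exact i g) (h : M →ₗ[R] E') : ∃ l : M →ₗ[R] E, ∀ m, g (l m) = h m := by
  obtain ⟨P0, P1, P2, d2, d1, ε, hP, hε, h1, h2, hN⟩ := ext1_data R M
  rw [hN] at H
  obtain ⟨u, hu⟩ := Module.projective_lifting_property g (h ∘ₗ ε) hg
  have hu (x) : g (u x) = h (ε x) := LinearMap.congr_fun hu x
  obtain ⟨v, hv⟩ := corestrict i hi (u ∘ₗ d1) (fun c => (hig _).1 (by
    simp [hu, (h1 _).2 ⟨c, rfl⟩]))
  obtain ⟨e, he⟩ := H v (by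
    ext x
    apply hi
    simp [hv, (h2 _).2 ⟨x, rfl⟩])
  have he (x) : v x = e (d1 x) := LinearMap.congr_fun he x
  obtain ⟨k, hk⟩ := descend ε hε (u - i ∘ₗ e) (by
    intro a ha
    obtain ⟨y, rfl⟩ := (h1 _).1 ha
    simp [← he, hv])
  refine ⟨k, fun m => ?_⟩
  obtain ⟨x, rfl⟩ := hε m
  rw [hk]
  simp [hu, (hig _).2 ⟨_, rfl⟩]

/-- Swap the arguments of a map to a character module. -/
def flipChar {R A B : Type} [CommRing R] [AddCommGroup A] [AddCommGroup B] [Module R A]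
    [Module R B] (f : A →ₗ[R] CharacterModule B) : B →ₗ[R] CharacterModule A where
  toFun b := AddMonoidHom.mk' (fun a => f a b) (fun x y => by rw [map_add]; rfl)
  map_add' x y := by
    ext a
    exact map_add (f a) x y
  map_smul' r x := by
    ext a
    change f a (r • x) = f (r • a) x
    rw [LinearMap.map_smul f]; rfl

theorem char_exact {R P M : Type} [CommRing R] [AddCommGroup P] [AddCommGroup M] [Module R P]
    [Module R M] (π : P →ₗ[R] M) (hπ : Function.Surjective π) (φ : CharacterModule P)
    (h : CharacterModule.dual (LinearMap.ker π).subtype φ = 0) :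
    ∃ ψ : CharacterModule M, CharacterModule.dual π ψ = φ := by
  obtain ⟨k, hk⟩ := descend π.toAddMonoidHom.toIntLinearMap hπ (AddMonoidHom.toIntLinearMap φ)
    (fun a ha => DFunLike.congr_fun h (⟨a, ha⟩ : LinearMap.ker π))
  exact ⟨k.toAddMonoidHom, CharacterModule.ext _ fun x => hk x⟩

theorem ext1Zero_char (R : Type) [CommRing R] (M N : Type) [AddCommGroup M] [Module R M]
    [AddCommGroup N] [Module R N] [Module.Flat R M] : ext1Zero R M (CharacterModule N) := by
  apply ext1Zero_of_extend
  intro P _ _ π hπ f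
  have hinj := Module.Flat.iff_characterModule_injective.1 (inferInstance : Module.Flat R M)
  obtain ⟨ρ, hρ⟩ := Module.Injective.extension_property R (CharacterModule M) _ _
    (CharacterModule.dual π) (CharacterModule.dual_injective_of_surjective π hπ) LinearMap.id
  have hρ (x) : ρ (CharacterModule.dual π x) = x := LinearMap.congr_fun hρ x
  have hs := CharacterModule.dual_surjective_of_injective (LinearMap.ker π).subtype
    (LinearMap.ker π).injective_subtype
  obtain ⟨σ, hσ⟩ := descend (CharacterModule.dual (LinearMap.ker π).subtype) hs
    (LinearMap.id - CharacterModule.dual π ∘ₗ ρ) (by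
      intro a ha
      obtain ⟨ψ, rfl⟩ := char_exact π hπ a ha
      rw [LinearMap.sub_apply, LinearMap.comp_apply, hρ, LinearMap.id_apply, sub_self])
  refine ⟨flipChar (σ ∘ₗ flipChar f), fun k => CharacterModule.ext _ fun n => ?_⟩
  obtain ⟨φ, hφ⟩ := hs (flipChar f n)
  change σ (flipChar f n) k.1 = f k n
  rw [← hφ, hσ]
  have h1 : φ k.1 = f k n := DFunLike.congr_fun hφ k
  change φ k.1 - ρ φ (π k.1) = _
  rw [h1, LinearMap.mem_ker.1 k.2, map_zero, sub_zero]

theorem flat_of_ext1Zero_char (R : Type) [CommRing R] (F : Type) [AddCommGroup F] [Module R F]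
    (H : ∀ (N : Type) [AddCommGroup N] [Module R N], ext1Zero R F (CharacterModule N)) :
    Module.Flat R F := by
  rw [Module.Flat.iff_characterModule_injective]
  obtain ⟨P, _, _, hP, π, hπ⟩ : ∃ (P : Type) (_ : AddCommGroup P) (_ : Module R P)
      (_ : Module.Flat R P) (π : P →ₗ[R] F), Function.Surjective π :=
    ⟨F →₀ R, inferInstance, inferInstance, inferInstance, Finsupp.linearCombination R (id : F → F),
      Finsupp.linearCombination_surjective _ Function.surjective_id⟩
  have hinj := Module.Flat.iff_characterModule_injective.1 hP
  obtain ⟨e, he⟩ := extend_of_ext1Zero R F _ (H (CharacterModule (LinearMap.ker π))) _ π hπ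
    (flipChar LinearMap.id)
  let σ := flipChar e
  have hσ (y) : CharacterModule.dual (LinearMap.ker π).subtype (σ y) = y := by
    ext k
    exact DFunLike.congr_fun (he k) y
  refine ⟨fun X Y _ _ _ _ f hf g => ?_⟩
  obtain ⟨h, hh⟩ := Module.Injective.extension_property R (CharacterModule P) _ _
    f hf (CharacterModule.dual π ∘ₗ g)
  have hh (x) : h (f x) = CharacterModule.dual π (g x) := LinearMap.congr_fun hh x
  have hi := CharacterModule.dual_injective_of_surjective π hπ
  obtain ⟨k, hk⟩ := corestrict (CharacterModule.dual π) hi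
    (h - σ ∘ₗ CharacterModule.dual (LinearMap.ker π).subtype ∘ₗ h) (fun y => by
      apply char_exact π hπ
      simp only [LinearMap.sub_apply, LinearMap.comp_apply, map_sub, hσ, sub_self])
  refine ⟨k, fun x => hi ?_⟩
  have h0 : CharacterModule.dual (LinearMap.ker π).subtype (CharacterModule.dual π (g x)) = 0 := by
    ext a
    change g x (π a.1) = 0
    rw [LinearMap.mem_ker.1 a.2, map_zero]
  rw [hk]
  simp only [LinearMap.sub_apply, LinearMap.comp_apply, hh, h0, map_zero, sub_zero]

theorem ext1Zero_loc (R : Type) [CommRing R] (S : Submonoid R) (D : Type) [AddCommGroup D]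
    [Module R D] [Module (Localization S) D] [IsScalarTower R (Localization S) D] :
    ext1Zero R (Localization S) D := by
  apply ext1Zero_of_extend
  intro P _ _ π hπ f
  let m := LocalizedModule.mkLinearMap S P
  have : IsLocalizedModule S (LinearMap.id : Localization S →ₗ[R] Localization S) :=
    isLocalizedModule_id S _ (Localization S)
  have hD : IsLocalizedModule S (LinearMap.id : D →ₗ[R] D) :=
    isLocalizedModule_id S _ (Localization S)
  let π' := IsLocalizedModule.map S m (LinearMap.id : Localization S →ₗ[R] Localization S) π
  have hπ' (p) : π' (m p) = π p := IsLocalizedModule.map_apply S m LinearMap.id π p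
  have hsm (a : Localization S) (x) : π' (a • x) = a • π' x :=
    (π'.extendScalarsOfIsLocalization S (Localization S)).map_smul a x
  let q := LinearMap.toKerIsLocalized S m (LinearMap.id : Localization S →ₗ[R] Localization S) π
  have hq : IsLocalizedModule S q :=
    LinearMap.toKerLocalized_isLocalizedModule (Localization S) S m LinearMap.id π
  let h := IsLocalizedModule.lift S q f hD.map_units
  have hh (k) : h (q k) = f k := IsLocalizedModule.lift_apply S q f hD.map_units k
  obtain ⟨p0, hp0⟩ := hπ 1
  let T : P →ₗ[R] LocalizedModule S P :=
    m - ((LinearMap.toSpanSingleton (Localization S) (LocalizedModule S P) (m p0)).restrictScalars R)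
      ∘ₗ π
  have hT (p) : T p = m p - π p • m p0 := rfl
  refine ⟨h ∘ₗ T.codRestrict (LinearMap.ker π') (fun p => ?_), fun k => ?_⟩
  · rw [LinearMap.mem_ker, hT, map_sub, hsm, hπ', hπ', hp0, smul_eq_mul, mul_one, sub_self]
  · rw [← hh, LinearMap.comp_apply]
    congr 1
    apply Subtype.ext
    change T k.1 = m k.1
    rw [hT, LinearMap.mem_ker.1 k.2, zero_smul, sub_zero]

theorem ext1Zero_quot (R : Type) [CommRing R] (S : Submonoid R) (s : R) (hs : s ∈ S) (D : Type)
    [AddCommGroup D] [Module R D] (hD : ∀ d : D, s • d = 0) :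
    ext1Zero R (Localization S) D := by
  apply ext1Zero_of_extend
  intro P _ _ π hπ f
  have hu : IsUnit (algebraMap R (Localization S) s) := IsLocalization.map_units _ ⟨s, hs⟩
  obtain ⟨k, hk⟩ := descend ((LinearMap.ker π).subtype.coprod (s • LinearMap.id : P →ₗ[R] P))
    (fun p => by
      obtain ⟨w, hw⟩ := hu.exists_right_inv
      obtain ⟨x, hx⟩ := hπ (w * π p)
      refine ⟨(⟨p - s • x, ?_⟩, x), by simp⟩
      rw [LinearMap.mem_ker, map_sub, map_smul, hx, Algebra.smul_def, ← mul_assoc, hw, one_mul,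
        sub_self])
    (f.coprod 0)
    (by
      rintro ⟨⟨a, ha⟩, x⟩ hax
      simp only [LinearMap.coprod_apply, Submodule.subtype_apply, LinearMap.smul_apply,
        LinearMap.id_apply, LinearMap.zero_apply, add_zero] at hax ⊢
      have hx : π x = 0 := by
        have := congrArg π hax
        rw [map_add, LinearMap.mem_ker.1 ha, zero_add, map_smul, map_zero, Algebra.smul_def] at this
        exact hu.mul_right_eq_zero.1 this
      have : (⟨a, ha⟩ : LinearMap.ker π) = s • ⟨-x, by simp [hx]⟩ :=
        Subtype.ext (by simpa using eq_neg_of_add_eq_zero_left hax)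
      rw [this, map_smul, hD])
  refine ⟨k, fun a => ?_⟩
  have := hk (a, 0)
  simpa using this

theorem stmt_12 (R : Type) [CommRing R] (S : Submonoid R)
    (F : Type) [AddCommGroup F] [Module R F] (hF : SStronglyFlat R S F) :
    OSStronglyFlat R S F := by
  refine ⟨?_, ?_, ?_⟩
  · apply flat_of_ext1Zero_char
    intro N _ _
    have : Module.Flat R (Localization S) := IsLocalization.flat _ S
    exact hF _ (ext1Zero_char R (Localization S) N)
  · refine Module.Projective.of_lifting_property'' fun g hg => ?_
    obtain ⟨l, hl⟩ := lift_of_ext1Zero R F (LinearMap.ker g) (hF _ (ext1Zero_loc R S _))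
      ((LinearMap.ker g).subtype.restrictScalars R) Subtype.val_injective
      (g.restrictScalars R) hg (fun x => by simp) (LocalizedModule.mkLinearMap S F)
    have hE : IsLocalizedModule S
        (LinearMap.id : (LocalizedModule S F →₀ Localization S) →ₗ[R] _) :=
      isLocalizedModule_id S _ (Localization S)
    let L := IsLocalizedModule.lift S (LocalizedModule.mkLinearMap S F) l hE.map_units
    have hL (x) : L (LocalizedModule.mkLinearMap S F x) = l x :=
      IsLocalizedModule.lift_apply S _ l hE.map_units x
    refine ⟨L.extendScalarsOfIsLocalization S (Localization S), ?_⟩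
    have key : g.restrictScalars R ∘ₗ L = LinearMap.id := by
      apply IsLocalizedModule.ext S (LocalizedModule.mkLinearMap S F)
        (IsLocalizedModule.map_units (LocalizedModule.mkLinearMap S F))
      ext x
      simp only [LinearMap.comp_apply, hL, hl, LinearMap.id_apply]
    ext x
    exact LinearMap.congr_fun key x
  · intro s hs
    refine Module.Projective.of_lifting_property'' fun g hg => ?_
    have hker : ∀ d : (F ⧸ (Ideal.span {s} • (⊤ : Submodule R F))) →₀ (R ⧸ Ideal.span {s}),
        ∀ r ∈ Ideal.span {s}, r • d = 0 := by
      intro d r hr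
      ext a
      rw [Finsupp.smul_apply, Algebra.smul_def, Ideal.Quotient.algebraMap_eq,
        Ideal.Quotient.eq_zero_iff_mem.2 hr, zero_mul]; rfl
    obtain ⟨l, hl⟩ := lift_of_ext1Zero R F (LinearMap.ker g)
      (hF _ (ext1Zero_quot R S s hs _ (fun d => Subtype.ext
        (hker d.1 s (Ideal.mem_span_singleton_self s)))))
      ((LinearMap.ker g).subtype.restrictScalars R) Subtype.val_injective
      (g.restrictScalars R) hg (fun x => by simp) (Submodule.mkQ _)
    let L := (Ideal.span {s} • (⊤ : Submodule R F)).liftQ l (by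
      rw [Submodule.smul_le]
      intro r hr n _
      rw [LinearMap.mem_ker, map_smul, hker _ r hr])
    refine ⟨{ toFun := L, map_add' := L.map_add, map_smul' := ?_ }, ?_⟩
    · intro r x
      obtain ⟨r, rfl⟩ := Ideal.Quotient.mk_surjective r
      have h1 : (Ideal.Quotient.mk (Ideal.span {s}) r) • x = r • x := 
        algebraMap_smul (R ⧸ Ideal.span {s}) r x
      have h2 : (Ideal.Quotient.mk (Ideal.span {s}) r) • L x = r • L x := 
        algebraMap_smul (R ⧸ Ideal.span {s}) r (L x)
      rw [h1, map_smul, RingHom.id_apply, h2]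
    · refine LinearMap.ext fun x => ?_
      obtain ⟨x, rfl⟩ := Submodule.mkQ_surjective _ x
      exact hl x
end
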